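/- arXiv:2407.06398 — 2 statements merged into one kernel-verified Lean document; each statement's English description precedes it below -/
import Mathlib

section
/- Let μ be a Borel probability measure on ℝ with finite first moment ∫ |x| dμ(x) < ∞, and let k ≥ 1. For each n ≥ 1 define SC_opt : ℝⁿ → ℝ by SC_opt(x) := inf_{y ∈ ℝᵏ} (1/n) ∑_{i=1}^n min_{1≤j≤k} |x_i − y_j|. Then the expected optimal social cost under n i.i.d. samples from μ converges to the Wasserstein projection distance of μ onto k-point measures: ∫_{ℝⁿ} SC_opt(x) d(μ^{⊗n})(x) → inf_{ν ∈ 𝒫_k(ℝ)} W₁(μ, ν) as n → ∞. -/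
open MeasureTheory Filter Topology ENNReal

/-- The 1-Wasserstein distance between two measures on ℝ, defined as the infimum of
transport costs over couplings. -/
noncomputable def W1 (α β : Measure ℝ) : ℝ :=
  sInf {c : ℝ | ∃ π : Measure (ℝ × ℝ), IsProbabilityMeasure π ∧
    π.map Prod.fst = α ∧ π.map Prod.snd = β ∧ c = ∫ p, |p.1 - p.2| ∂π}

/-- The ∞-Wasserstein distance between two measures on ℝ. -/
noncomputable def Winf (α β : Measure ℝ) : ℝ :=
  sInf {c : ℝ | ∃ π : Measure (ℝ × ℝ), IsProbabilityMeasure π ∧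
    π.map Prod.fst = α ∧ π.map Prod.snd = β ∧
    c = essSup (fun p : ℝ × ℝ => |p.1 - p.2|) π}

/-- `Pk k` : probability measures on ℝ supported on at most `k` points. -/
def Pk (k : ℕ) : Set (Measure ℝ) :=
  {ν | IsProbabilityMeasure ν ∧ ∃ s : Finset ℝ, s.card ≤ k ∧ ν ((↑s : Set ℝ)ᶜ) = 0}

/-- Wasserstein projection distance of `μ` onto `k`-point measures. -/
noncomputable def projDist (k : ℕ) (μ : Measure ℝ) : ℝ :=
  sInf {c : ℝ | ∃ ν ∈ Pk k, c = W1 μ ν}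

/-- Empirical measure of a tuple of points. -/
noncomputable def empMeas {n : ℕ} (x : Fin n → ℝ) : Measure ℝ :=
  ((n : ℝ≥0∞))⁻¹ • ∑ i : Fin n, Measure.dirac (x i)

/-- Social cost of facility placement `y` for agents at `x`. -/
noncomputable def SC {n k : ℕ} (x : Fin n → ℝ) (y : Fin k → ℝ) : ℝ :=
  (n : ℝ)⁻¹ * ∑ i : Fin n, ⨅ j : Fin k, |x i - y j|

/-- Optimal social cost for `k` facilities. -/
noncomputable def SCopt (k : ℕ) {n : ℕ} (x : Fin n → ℝ) : ℝ :=
  ⨅ y : Fin k → ℝ, SC x y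

/-- Topological support of a measure on ℝ. -/
def msupport (ν : Measure ℝ) : Set ℝ := {t : ℝ | ∀ U ∈ nhds t, ν U ≠ 0}

/-- Cumulative distribution function of a measure on ℝ. -/
noncomputable def mcdf (μ : Measure ℝ) (t : ℝ) : ℝ := (μ (Set.Iic t)).toReal

/-- Quantile (generalized inverse c.d.f.) of a measure on ℝ. -/
noncomputable def mquantile (μ : Measure ℝ) (v : ℝ) : ℝ := sInf {t : ℝ | v ≤ mcdf μ t}

/-- Basic assumptions: `μ` is an absolutely continuous probability measure with density `ρ`,
supported on a (closed) interval `S`, with `ρ` positive on the interior of `S`, vanishing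
outside `S`, and differentiable on `S`. -/
def BasicAssumptions (μ : Measure ℝ) : Prop :=
  IsProbabilityMeasure μ ∧
  ∃ (ρ : ℝ → ℝ) (S : Set ℝ),
    μ = volume.withDensity (fun x => ENNReal.ofReal (ρ x)) ∧
    IsClosed S ∧ S.OrdConnected ∧ μ Sᶜ = 0 ∧
    (∀ x ∈ interior S, 0 < ρ x) ∧ (∀ x ∉ S, ρ x = 0) ∧
    DifferentiableOn ℝ ρ S

/-- The percentile mechanism: facility `j` is placed at the `(⌊(n-1)vⱼ⌋+1)`-th smallest
coordinate of `x`. -/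
noncomputable def percentileMech {k : ℕ} (v : Fin k → ℝ) {n : ℕ} (x : Fin n → ℝ) :
    Fin k → ℝ :=
  fun j =>
    if h : 0 < n then
      x (Tuple.sort x ⟨min ⌊((n : ℝ) - 1) * v j⌋₊ (n - 1),
        Nat.lt_of_le_of_lt (min_le_right _ _) (by omega)⟩)
    else 0

/-- Social cost of the percentile mechanism with percentile vector `v`. -/
noncomputable def SCv {k : ℕ} (v : Fin k → ℝ) {n : ℕ} (x : Fin n → ℝ) : ℝ :=
  SC x (percentileMech v x)

/-- Cumulative masses of the Voronoi cells of the points `y 0 < y 1 < ⋯ < y (k-1)`: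
`cellBd μ y j = F_μ(z_j)` where `z_j = (y (j-1) + y j)/2` for `1 ≤ j ≤ k-1` (1-based),
with the conventions `F_μ(z_0) = 0` and `F_μ(z_k) = 1`. -/
noncomputable def cellBd (μ : Measure ℝ) {k : ℕ} (y : Fin k → ℝ) (j : ℕ) : ℝ :=
  if h0 : j = 0 then 0
  else if hk : k ≤ j then 1
  else mcdf μ ((y ⟨j - 1, by omega⟩ + y ⟨j, by omega⟩) / 2)

/-- The measure `ν_{Q_v}`: atoms at the quantiles `F_μ^{[-1]}(vⱼ)` weighted by the masses of
their Voronoi cells. -/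
noncomputable def nuQ (μ : Measure ℝ) {k : ℕ} (v : Fin k → ℝ) : Measure ℝ :=
  ∑ i : Fin k,
    ENNReal.ofReal (cellBd μ (fun j => mquantile μ (v j)) ((i : ℕ) + 1) -
        cellBd μ (fun j => mquantile μ (v j)) (i : ℕ)) •
      Measure.dirac (mquantile μ (v i))

section NearestDist

variable {k : ℕ}

/-- Distance from `x` to the nearest of the points `y j`. -/
noncomputable def nearestDist (y : Fin k → ℝ) (x : ℝ) : ℝ := ⨅ j : Fin k, |x - y j|

lemma nearestDist_nonneg (y : Fin k → ℝ) (x : ℝ) : 0 ≤ nearestDist y x :=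
  Real.iInf_nonneg fun _ => abs_nonneg _

lemma nearestDist_le (y : Fin k → ℝ) (x : ℝ) (j : Fin k) : nearestDist y x ≤ |x - y j| :=
  ciInf_le (Set.finite_range _).bddBelow j

lemma exists_nearestDist_eq [NeZero k] (y : Fin k → ℝ) (x : ℝ) :
    ∃ j, nearestDist y x = |x - y j| := by
  obtain ⟨j, hj⟩ := exists_eq_ciInf_of_finite (f := fun j => |x - y j|)
  exact ⟨j, hj.symm⟩

lemma nearestDist_le_add [NeZero k] (y y' : Fin k → ℝ) (x x' : ℝ) :
    nearestDist y x ≤ nearestDist y' x' + |x - x'| + dist y' y := by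
  obtain ⟨j, hj⟩ := exists_nearestDist_eq y' x'
  have h1 := nearestDist_le y x j
  have h2 : |y' j - y j| ≤ dist y' y := dist_le_pi_dist y' y j
  have h3 : |x - y j| ≤ |x - x'| + |x' - y' j| + |y' j - y j| := by
    have := abs_add_three (x - x') (x' - y' j) (y' j - y j)
    simpa using this
  linarith

lemma continuous_nearestDist [NeZero k] (y : Fin k → ℝ) : Continuous (nearestDist y) := by
  refine (LipschitzWith.of_le_add (f := nearestDist y) fun x x' => ?_).continuous
  simpa [Real.dist_eq] using nearestDist_le_add y y x x'

lemma integrable_abs_sub {μ : Measure ℝ} [IsFiniteMeasure μ]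
    (hμ : Integrable (fun x : ℝ => |x|) μ) (a : ℝ) : Integrable (fun x => |x - a|) μ :=
  ((integrable_norm_iff measurable_id.aestronglyMeasurable).1 hμ
    |>.sub (integrable_const a)).abs

lemma integrable_nearestDist [NeZero k] {μ : Measure ℝ} [IsFiniteMeasure μ]
    (hμ : Integrable (fun x : ℝ => |x|) μ) (y : Fin k → ℝ) : Integrable (nearestDist y) μ := by
  refine (integrable_abs_sub hμ (y 0)).mono' (continuous_nearestDist y).aestronglyMeasurable
    (ae_of_all _ fun x => ?_)
  rw [Real.norm_of_nonneg (nearestDist_nonneg y x)]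
  exact nearestDist_le y x 0

/-- Optimal expected distance of a `μ`-distributed point to `k` facilities. -/
noncomputable def optDist (k : ℕ) (μ : Measure ℝ) : ℝ :=
  ⨅ y : Fin k → ℝ, ∫ x, nearestDist y x ∂μ

lemma optDist_le (μ : Measure ℝ) (y : Fin k → ℝ) : optDist k μ ≤ ∫ x, nearestDist y x ∂μ :=
  ciInf_le ⟨0, by rintro _ ⟨y, rfl⟩; exact integral_nonneg (nearestDist_nonneg y)⟩ y

/-- Clamping the facilities to `[-R, R]` increases the cost only outside `[-R, R]`. -/
lemma nearestDist_clamp_le [NeZero k] {R : ℝ} (hR : 0 ≤ R) (y : Fin k → ℝ) (x : ℝ) :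
    nearestDist (fun j => max (-R) (min R (y j))) x ≤
      nearestDist y x + {x : ℝ | R < |x|}.indicator (fun x => 2 * |x|) x := by
  obtain ⟨j, hj⟩ := exists_nearestDist_eq y x
  refine (nearestDist_le _ x j).trans ?_
  by_cases hx : R < |x|
  · rw [Set.indicator_of_mem (show x ∈ {x : ℝ | R < |x|} from hx)]
    have h0 := nearestDist_nonneg y x
    have h1 : |max (-R) (min R (y j))| ≤ R :=
      abs_le.2 ⟨le_max_left _ _, max_le (by linarith) (min_le_left _ _)⟩
    have h2 := abs_sub x (max (-R) (min R (y j)))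
    linarith
  · rw [Set.indicator_of_notMem (show x ∉ {x : ℝ | R < |x|} from hx), hj, add_zero]
    obtain ⟨h1, h2⟩ := abs_le.1 (not_lt.1 hx)
    have h3 : max (-R) (min R x) = x := by rw [min_eq_right h2, max_eq_right h1]
    conv_lhs => rw [← h3]
    calc |max (-R) (min R x) - max (-R) (min R (y j))|
        ≤ |min R x - min R (y j)| := by
          simpa using abs_max_sub_max_le_max (-R) (min R x) (-R) (min R (y j))
      _ ≤ |x - y j| := by simpa using abs_min_sub_min_le_max R x R (y j)

end NearestDist

section Projection

lemma W1_le {α β : Measure ℝ} (π : Measure (ℝ × ℝ)) [hπ : IsProbabilityMeasure π]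
    (h1 : π.map Prod.fst = α) (h2 : π.map Prod.snd = β) : W1 α β ≤ ∫ p, |p.1 - p.2| ∂π :=
  csInf_le ⟨0, by rintro _ ⟨π, -, -, -, rfl⟩; exact integral_nonneg fun _ => abs_nonneg _⟩
    ⟨π, hπ, h1, h2, rfl⟩

lemma W1_nonneg (α β : Measure ℝ) : 0 ≤ W1 α β :=
  Real.sInf_nonneg (by
    rintro _ ⟨π, -, -, -, rfl⟩; exact integral_nonneg fun _ => abs_nonneg _)

/-- Sending every point to its nearest facility transports `μ` to a `k`-point measure. -/
lemma exists_mem_Pk_W1_le {k : ℕ} [NeZero k] (μ : Measure ℝ) [IsProbabilityMeasure μ]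
    (hμ : Integrable (fun x : ℝ => |x|) μ) (y : Fin k → ℝ) :
    ∃ ν ∈ Pk k, W1 μ ν ≤ ∫ x, nearestDist y x ∂μ := by
  set e : ℕ → ℝ := fun i => y (Fin.ofNat k i) with he
  set T := SimpleFunc.nearestPt e (k - 1) with hT
  have hTm : Measurable T := T.measurable
  have hTmem : ∀ x, T x ∈ (Finset.univ.image y : Finset ℝ) := fun x =>
    Finset.mem_image.2 ⟨_, Finset.mem_univ _, rfl⟩
  have hTle : ∀ x, |x - T x| ≤ nearestDist y x := by
    intro x
    obtain ⟨j, hj⟩ := exists_nearestDist_eq y x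
    have h := SimpleFunc.edist_nearestPt_le e x (k := j) (N := k - 1) (by omega)
    rw [edist_dist, edist_dist, ENNReal.ofReal_le_ofReal_iff dist_nonneg] at h
    have hej : e j = y j := by simp [he]
    rw [hej, dist_comm, dist_comm (y j)] at h
    rw [hj]
    exact h
  refine ⟨μ.map T, ⟨Measure.isProbabilityMeasure_map hTm.aemeasurable, Finset.univ.image y,
    Finset.card_image_le.trans (by simp), ?_⟩, ?_⟩
  · rw [Measure.map_apply hTm (Finset.measurableSet _).compl]
    convert measure_empty (μ := μ)
    ext x
    simpa using hTmem x
  · have hm : Measurable fun x => (x, T x) := measurable_id.prodMk hTm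
    have := Measure.isProbabilityMeasure_map (μ := μ) hm.aemeasurable
    refine (W1_le (μ.map fun x => (x, T x)) ?_ ?_).trans ?_
    · rw [Measure.map_map measurable_fst hm]
      exact Measure.map_id
    · rw [Measure.map_map measurable_snd hm]
      rfl
    · rw [integral_map hm.aemeasurable (by fun_prop)]
      exact integral_mono_of_nonneg (ae_of_all _ fun _ => abs_nonneg _)
        (integrable_nearestDist hμ y) (ae_of_all _ hTle)

lemma optDist_le_W1 {k : ℕ} (μ : Measure ℝ) [IsProbabilityMeasure μ]
    (hμ : Integrable (fun x : ℝ => |x|) μ) [NeZero k] {ν : Measure ℝ} (hν : ν ∈ Pk k) :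
    optDist k μ ≤ W1 μ ν := by
  obtain ⟨hprob, s, hs, hsν⟩ := hν
  have hne : s.Nonempty := by
    by_contra h
    rw [Finset.not_nonempty_iff_eq_empty] at h
    subst h
    simp at hsν
  have : Nonempty s := hne.to_subtype
  obtain ⟨y, hy⟩ : ∃ y : Fin k → ℝ, ∀ a ∈ s, ∃ j, y j = a := by
    obtain ⟨f⟩ : Nonempty (s ↪ Fin k) := Function.Embedding.nonempty_of_card_le (by simpa using hs)
    exact ⟨fun j => (Function.invFun f j : s), fun a ha =>
      ⟨f ⟨a, ha⟩, congrArg Subtype.val (Function.leftInverse_invFun f.injective ⟨a, ha⟩)⟩⟩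
  refine le_csInf ⟨_, μ.prod ν, inferInstance, by simp, by simp, rfl⟩ ?_
  rintro _ ⟨π, hπ, h1, h2, rfl⟩
  have hmem : ∀ᵐ p ∂π, p.2 ∈ s := by
    have h : ∀ᵐ a ∂(π.map Prod.snd), a ∈ s := by
      rw [h2]
      exact hsν
    exact ae_of_ae_map measurable_snd.aemeasurable h
  have hfst : Integrable (fun p : ℝ × ℝ => |p.1|) π := by
    rw [← h1] at hμ
    exact hμ.comp_measurable measurable_fst
  have hint : Integrable (fun p : ℝ × ℝ => |p.1 - p.2|) π := by
    refine (hfst.add (integrable_const (∑ a ∈ s, |a|))).mono' (by fun_prop) ?_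
    filter_upwards [hmem] with p hp
    have hb := Finset.single_le_sum (f := fun a : ℝ => |a|) (fun _ _ => abs_nonneg _) hp
    have := abs_sub p.1 p.2
    simp only [Real.norm_eq_abs, abs_abs, Pi.add_apply]
    linarith
  refine (optDist_le μ y).trans ?_
  rw [← h1, integral_map measurable_fst.aemeasurable
    (continuous_nearestDist y).aestronglyMeasurable]
  refine integral_mono_of_nonneg (ae_of_all _ fun p => nearestDist_nonneg y p.1) hint ?_
  filter_upwards [hmem] with p hp
  obtain ⟨j, hj⟩ := hy _ hp
  simpa [hj] using nearestDist_le y p.1 j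

lemma projDist_eq_optDist {k : ℕ} [NeZero k] (μ : Measure ℝ) [IsProbabilityMeasure μ]
    (hμ : Integrable (fun x : ℝ => |x|) μ) : projDist k μ = optDist k μ := by
  refine le_antisymm (le_ciInf fun y => ?_) (le_csInf ?_ ?_)
  · obtain ⟨ν, hν, h⟩ := exists_mem_Pk_W1_le μ hμ y
    have hle : projDist k μ ≤ W1 μ ν :=
      csInf_le ⟨0, by rintro _ ⟨ν, -, rfl⟩; exact W1_nonneg _ _⟩ ⟨ν, hν, rfl⟩
    exact hle.trans h
  · obtain ⟨ν, hν, -⟩ := exists_mem_Pk_W1_le μ hμ (0 : Fin k → ℝ)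
    exact ⟨_, ν, hν, rfl⟩
  · rintro _ ⟨ν, hν, rfl⟩
    exact optDist_le_W1 μ hμ hν

end Projection

section Sampling

variable {μ : Measure ℝ} [IsProbabilityMeasure μ]

lemma integrable_sampleMean {f : ℝ → ℝ} (hf : Integrable f μ) (n : ℕ) :
    Integrable (fun x : Fin n → ℝ => (n : ℝ)⁻¹ * ∑ i, f (x i)) (Measure.pi fun _ => μ) :=
  (integrable_finsetSum _ fun _ _ => integrable_comp_eval hf).const_mul _

lemma integral_sampleMean {f : ℝ → ℝ} (hf : Integrable f μ) {n : ℕ} (hn : n ≠ 0) :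
    ∫ x : Fin n → ℝ, (n : ℝ)⁻¹ * ∑ i, f (x i) ∂(Measure.pi fun _ => μ) = ∫ t, f t ∂μ := by
  rw [integral_const_mul, integral_finsetSum _ fun _ _ => integrable_comp_eval hf]
  have h : ∀ i : Fin n, ∫ x : Fin n → ℝ, f (x i) ∂(Measure.pi fun _ => μ) = ∫ t, f t ∂μ :=
    fun i => integral_comp_eval (μ := fun _ : Fin n => μ) hf.aestronglyMeasurable
  simp [h, hn]

/-- The `L¹` law of large numbers on the finite product spaces. -/
lemma tendsto_integral_abs_sampleMean_sub {f : ℝ → ℝ} (hfm : Measurable f)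
    (hf : Integrable f μ) :
    Tendsto (fun n : ℕ => ∫ x : Fin n → ℝ, |(n : ℝ)⁻¹ * ∑ i, f (x i) - ∫ t, f t ∂μ|
      ∂(Measure.pi fun _ => μ)) atTop (𝓝 0) := by
  set P := Measure.infinitePi fun _ : ℕ => μ with hP
  have heval : ∀ i, P.map (fun ω => ω i) = μ := fun i => Measure.infinitePi_map_eval _ i
  have hint : ∀ i, Integrable (fun ω : ℕ → ℝ => f (ω i)) P := fun i => by
    have h := hf
    rw [← heval i] at h
    exact h.comp_measurable (measurable_pi_apply i)
  have hmean : ∫ ω, f (ω 0) ∂P = ∫ t, f t ∂μ := by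
    rw [← integral_map (measurable_pi_apply 0).aemeasurable hfm.aestronglyMeasurable, heval 0]
  have hlaw := ProbabilityTheory.strong_law_Lp (μ := P) le_rfl one_ne_top
    (fun i ω => f (ω i)) (memLp_one_iff_integrable.2 (hint 0))
    (fun i j hij => (ProbabilityTheory.iIndepFun_infinitePi (P := fun _ : ℕ => μ)
      (X := fun _ => f) fun _ => hfm).indepFun hij)
    (fun i => (ProbabilityTheory.IdentDistrib.mk (measurable_pi_apply i).aemeasurable
      (measurable_pi_apply 0).aemeasurable ((heval i).trans (heval 0).symm)).comp hfm)
  have htoReal := (tendsto_toReal zero_ne_top).comp hlaw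
  rw [toReal_zero] at htoReal
  refine htoReal.congr fun n => ?_
  have hmap : P.map (fun ω (i : Fin n) => ω i) = Measure.pi fun _ : Fin n => μ := by
    rw [← Measure.infinitePi_eq_pi]
    exact Measure.map_infinitePi_infinitePi_of_inj (P := fun _ : ℕ => μ) Fin.val_injective
  have hproj : Measurable fun (ω : ℕ → ℝ) (i : Fin n) => ω i := by fun_prop
  have hdev : Measurable fun x : Fin n → ℝ => |(n : ℝ)⁻¹ * ∑ i, f (x i) - ∫ t, f t ∂μ| := by
    fun_prop
  rw [← hmap, integral_map hproj.aemeasurable hdev.aestronglyMeasurable, Function.comp_apply,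
    eLpNorm_one_eq_lintegral_enorm, ← integral_norm_eq_lintegral_enorm]
  · simp only [hmean, Finset.sum_range, smul_eq_mul, Real.norm_eq_abs]
  · refine Measurable.aestronglyMeasurable ?_
    fun_prop

end Sampling

lemma exists_tail_integral_lt {μ : Measure ℝ}
    (hμ : Integrable (fun x : ℝ => |x|) μ) {δ : ℝ} (hδ : 0 < δ) :
    ∃ R : ℝ, 0 ≤ R ∧ ∫ x, {x : ℝ | R < |x|}.indicator (fun x => 2 * |x|) x ∂μ < δ := by
  have h : Tendsto (fun R : ℕ => ∫ x, {x : ℝ | (R : ℝ) < |x|}.indicator (fun x => 2 * |x|) x ∂μ)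
      atTop (𝓝 (∫ _, (0 : ℝ) ∂μ)) := by
    refine tendsto_integral_of_dominated_convergence (fun x => 2 * |x|) (fun R => ?_)
      (hμ.const_mul 2) (fun R => ae_of_all _ fun x => ?_) (ae_of_all _ fun x => ?_)
    · exact ((by fun_prop : Measurable fun x : ℝ => 2 * |x|).indicator
        (measurableSet_lt measurable_const (by fun_prop))).aestronglyMeasurable
    · refine (norm_indicator_le_norm_self _ _).trans ?_
      simp
    · obtain ⟨N, hN⟩ := exists_nat_ge |x|
      refine tendsto_const_nhds.congr' ?_
      filter_upwards [eventually_ge_atTop N] with R hR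
      refine (Set.indicator_of_notMem ?_ _).symm
      have : (N : ℝ) ≤ R := by exact_mod_cast hR
      simpa using hN.trans this
  rw [integral_zero] at h
  obtain ⟨R, hR⟩ := (h.eventually_lt_const hδ).exists
  exact ⟨R, R.cast_nonneg, hR⟩

section SocialCost

variable {k n : ℕ}

lemma SC_eq (x : Fin n → ℝ) (y : Fin k → ℝ) :
    SC x y = (n : ℝ)⁻¹ * ∑ i, nearestDist y (x i) := rfl

lemma SC_nonneg (x : Fin n → ℝ) (y : Fin k → ℝ) : 0 ≤ SC x y :=
  mul_nonneg (by positivity) (Finset.sum_nonneg fun _ _ => nearestDist_nonneg y _)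

lemma bddBelow_range_SC (x : Fin n → ℝ) : BddBelow (Set.range fun y : Fin k → ℝ => SC x y) :=
  ⟨0, by rintro _ ⟨y, rfl⟩; exact SC_nonneg x y⟩

lemma SCopt_le (x : Fin n → ℝ) (y : Fin k → ℝ) : SCopt k x ≤ SC x y :=
  ciInf_le (bddBelow_range_SC x) y

lemma SCopt_nonneg (x : Fin n → ℝ) : 0 ≤ SCopt k x := Real.iInf_nonneg (SC_nonneg x)

lemma measurable_SCopt [NeZero k] : Measurable fun x : Fin n → ℝ => SCopt k x := by
  refine (upperSemicontinuous_ciInf bddBelow_range_SC fun y => ?_).measurable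
  refine Continuous.upperSemicontinuous ?_
  simp only [SC_eq]
  have := continuous_nearestDist y
  fun_prop

lemma integrable_SCopt [NeZero k] {μ : Measure ℝ} [IsProbabilityMeasure μ]
    (hμ : Integrable (fun x : ℝ => |x|) μ) :
    Integrable (fun x : Fin n → ℝ => SCopt k x) (Measure.pi fun _ => μ) := by
  refine (integrable_sampleMean (integrable_nearestDist hμ (0 : Fin k → ℝ)) n).mono'
    measurable_SCopt.aestronglyMeasurable (ae_of_all _ fun x => ?_)
  rw [Real.norm_of_nonneg (SCopt_nonneg x)]
  exact SCopt_le x 0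

lemma integral_SCopt_le_optDist [NeZero k] {μ : Measure ℝ} [IsProbabilityMeasure μ]
    (hμ : Integrable (fun x : ℝ => |x|) μ) (hn : n ≠ 0) :
    ∫ x : Fin n → ℝ, SCopt k x ∂(Measure.pi fun _ => μ) ≤ optDist k μ := by
  refine le_ciInf fun y => ?_
  rw [← integral_sampleMean (integrable_nearestDist hμ y) hn]
  exact integral_mono (integrable_SCopt hμ)
    (integrable_sampleMean (integrable_nearestDist hμ y) n) fun x => SCopt_le x y

/-- Uniform lower bound for the social cost, up to a small error, in terms of the sampling
errors of finitely many facility placements. -/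
lemma exists_finset_le_SCopt [NeZero k] (μ : Measure ℝ) {R δ : ℝ} (hR : 0 ≤ R) (hδ : 0 < δ) :
    ∃ t : Finset (Fin k → ℝ), ∀ n : ℕ, n ≠ 0 → ∀ x : Fin n → ℝ,
      optDist k μ - δ - ∑ y ∈ t, |(n : ℝ)⁻¹ * ∑ i, nearestDist y (x i) - ∫ s, nearestDist y s ∂μ| -
        (n : ℝ)⁻¹ * ∑ i, {x : ℝ | R < |x|}.indicator (fun x => 2 * |x|) (x i) ≤ SCopt k x := by
  obtain ⟨t, -, htfin, hcover⟩ := finite_cover_balls_of_compact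
    (isCompact_Icc (a := fun _ : Fin k => -R) (b := fun _ => R)) hδ
  refine ⟨htfin.toFinset, fun n hn x => le_ciInf fun y => ?_⟩
  have hclamp : (fun j => max (-R) (min R (y j))) ∈
      Set.Icc (fun _ : Fin k => -R) (fun _ => R) :=
    ⟨fun j => le_max_left _ _, fun j => max_le (by linarith) (min_le_left _ _)⟩
  obtain ⟨z, hz, hdist⟩ := Set.mem_iUnion₂.1 (hcover hclamp)
  have hpoint : ∀ s, nearestDist z s ≤
      nearestDist y s + {x : ℝ | R < |x|}.indicator (fun x => 2 * |x|) s + δ := fun s => by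
    have h1 := nearestDist_le_add z (fun j => max (-R) (min R (y j))) s s
    have h2 := nearestDist_clamp_le hR y s
    have h3 := Metric.mem_ball.1 hdist
    simp only [sub_self, abs_zero] at h1
    linarith
  have hmean : (n : ℝ)⁻¹ * ∑ i, nearestDist z (x i) ≤ SC x y +
      (n : ℝ)⁻¹ * ∑ i, {x : ℝ | R < |x|}.indicator (fun x => 2 * |x|) (x i) + δ := by
    have h := mul_le_mul_of_nonneg_left (Finset.sum_le_sum fun i (_ : i ∈ Finset.univ) =>
      hpoint (x i)) (by positivity : (0 : ℝ) ≤ (n : ℝ)⁻¹)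
    have hn' : (n : ℝ) ≠ 0 := by exact_mod_cast hn
    simp only [Finset.sum_add_distrib, mul_add, Finset.sum_const, Finset.card_univ,
      Fintype.card_fin, nsmul_eq_mul, inv_mul_cancel_left₀ hn'] at h
    exact h
  have hdev := Finset.single_le_sum
    (f := fun y => |(n : ℝ)⁻¹ * ∑ i, nearestDist y (x i) - ∫ s, nearestDist y s ∂μ|)
    (fun _ _ => abs_nonneg _) (htfin.mem_toFinset.2 hz)
  have habs := neg_abs_le ((n : ℝ)⁻¹ * ∑ i, nearestDist z (x i) - ∫ s, nearestDist z s ∂μ)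
  have hopt := optDist_le μ z
  linarith

lemma eventually_lt_integral_SCopt [NeZero k] {μ : Measure ℝ} [IsProbabilityMeasure μ]
    (hμ : Integrable (fun x : ℝ => |x|) μ) {ε : ℝ} (hε : 0 < ε) :
    ∀ᶠ n : ℕ in atTop,
      optDist k μ - ε < ∫ x : Fin n → ℝ, SCopt k x ∂(Measure.pi fun _ => μ) := by
  obtain ⟨R, hR, htail⟩ := exists_tail_integral_lt hμ (by positivity : 0 < ε / 3)
  obtain ⟨t, ht⟩ := exists_finset_le_SCopt (k := k) μ hR (by positivity : 0 < ε / 3)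
  have htail_int : Integrable ({x : ℝ | R < |x|}.indicator fun x => 2 * |x|) μ :=
    (hμ.const_mul 2).indicator (measurableSet_lt measurable_const (by fun_prop))
  have hdev := tendsto_finsetSum t fun y _ =>
    tendsto_integral_abs_sampleMean_sub (continuous_nearestDist y).measurable
      (integrable_nearestDist hμ y)
  rw [Finset.sum_const_zero] at hdev
  filter_upwards [hdev.eventually_lt_const (by positivity : 0 < ε / 3), eventually_ne_atTop 0]
    with n hn hn0
  have hdev_int : ∀ y ∈ t, Integrable (fun x : Fin n → ℝ =>
      |(n : ℝ)⁻¹ * ∑ i, nearestDist y (x i) - ∫ s, nearestDist y s ∂μ|)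
      (Measure.pi fun _ => μ) := fun y _ =>
    ((integrable_sampleMean (integrable_nearestDist hμ y) n).sub (integrable_const _)).abs
  have hsum_int := integrable_finsetSum t hdev_int
  have hmean_int := integrable_sampleMean htail_int n
  have h := integral_mono (((integrable_const (optDist k μ - ε / 3)).sub hsum_int).sub hmean_int)
    (integrable_SCopt hμ) (ht n hn0)
  have hlhs := integral_sub ((integrable_const (optDist k μ - ε / 3)).sub hsum_int) hmean_int
  have hlhs' := integral_sub (integrable_const (optDist k μ - ε / 3)) hsum_int
  rw [integral_sampleMean htail_int hn0] at hlhs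
  rw [integral_finsetSum _ hdev_int, integral_const, probReal_univ, one_smul] at hlhs'
  simp only [Pi.sub_apply] at h hlhs hlhs'
  linarith

end SocialCost

/-- The expected optimal social cost of `n` i.i.d. agents converges to the
Wasserstein projection distance of `μ` onto `k`-point measures. -/
theorem stmt2 (μ : Measure ℝ) [IsProbabilityMeasure μ]
    (hμ : Integrable (fun x : ℝ => |x|) μ) (k : ℕ) (hk : 1 ≤ k) :
    Tendsto (fun n : ℕ => ∫ x : Fin n → ℝ, SCopt k x ∂(Measure.pi fun _ : Fin n => μ))
      atTop (𝓝 (projDist k μ)) := by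
  have : NeZero k := ⟨by omega⟩
  rw [projDist_eq_optDist μ hμ]
  refine tendsto_order.2 ⟨fun a ha => ?_, fun a ha => ?_⟩
  · filter_upwards [eventually_lt_integral_SCopt (k := k) hμ (sub_pos.2 ha)] with n hn
    linarith
  · filter_upwards [eventually_ne_atTop 0] with n hn
    exact (integral_SCopt_le_optDist hμ hn).trans_lt ha
end

section
/- Let μ be a Borel probability measure on ℝ satisfying the basic assumptions and having finite first moment ∫ |x| dμ < ∞, let k ≥ 1, and let v ∈ (0,1)ᵏ be a nondecreasing percentile vector. For each n > k let SC_v : ℝⁿ → ℝ be the social cost of the percentile mechanism, SC_v(x) := (1/n) ∑_{i=1}^n min_{1≤j≤k} |x_i − y_j(x)| where y(x) := PM_v(x). Then ∫_{ℝⁿ} SC_v(x) d(μ^{⊗n})(x) → W₁(μ, ν_{Q_v}) as n → ∞. -/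
open MeasureTheory Filter Topology ENNReal

theorem mcdf_eq_cdf (μ : Measure ℝ) [IsProbabilityMeasure μ] (t : ℝ) :
    mcdf μ t = ProbabilityTheory.cdf μ t := by
  rw [ProbabilityTheory.cdf_eq_real]; rfl

theorem mcdf_mono (μ : Measure ℝ) [IsProbabilityMeasure μ] : Monotone (mcdf μ) := by
  intro a b hab
  rw [mcdf_eq_cdf, mcdf_eq_cdf]
  exact ProbabilityTheory.monotone_cdf μ hab

theorem mcdf_lt_of_lt_mquantile (μ : Measure ℝ) [IsProbabilityMeasure μ] {u t : ℝ}
    (hu : 0 < u) (ht : t < mquantile μ u) : mcdf μ t < u := by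
  by_contra! h
  obtain ⟨s, hs⟩ := ((ProbabilityTheory.tendsto_cdf_atBot μ).eventually_lt_const hu).exists
  have hb : BddBelow {t : ℝ | u ≤ mcdf μ t} := by
    refine ⟨s, fun r hr => ?_⟩
    by_contra! hrs
    have h1 := mcdf_mono μ hrs.le
    rw [mcdf_eq_cdf μ s] at h1
    exact absurd (lt_of_le_of_lt h1 hs) (not_lt.mpr hr)
  exact absurd (csInf_le hb h) (not_le.mpr ht)

theorem BasicAssumptions.measure_Ioo_pos {μ : Measure ℝ} (hμ : BasicAssumptions μ) {s t : ℝ}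
    (hst : s < t) (hs : μ (Set.Iic s) ≠ 0) (ht : μ (Set.Ioi t) ≠ 0) : μ (Set.Ioo s t) ≠ 0 := by
  obtain ⟨_, ρ, S, hρ, -, hconn, hS, hpos, -, hdiff⟩ := hμ
  have meets (A : Set ℝ) (hA : μ A ≠ 0) : ∃ a ∈ A, a ∈ S := by
    by_contra! h
    exact hA (measure_mono_null h hS)
  obtain ⟨a, ha, haS⟩ := meets _ hs
  obtain ⟨b, hb, hbS⟩ := meets _ ht
  have hsub : Set.Ioo s t ⊆ S := fun y hy =>
    hconn.out haS hbS ⟨le_trans ha hy.1.le, le_trans hy.2.le (le_of_lt hb)⟩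
  have hint : Set.Ioo s t ⊆ interior S := interior_maximal hsub isOpen_Ioo
  rw [hρ, withDensity_apply _ measurableSet_Ioo]
  have hmeas : AEMeasurable (fun x => ENNReal.ofReal (ρ x)) (volume.restrict (Set.Ioo s t)) :=
    ((hdiff.continuousOn.mono hsub).aemeasurable measurableSet_Ioo).ennreal_ofReal
  intro h0
  rw [lintegral_eq_zero_iff' hmeas, Filter.EventuallyEq,
    ae_restrict_iff' measurableSet_Ioo] at h0
  have : volume (Set.Ioo s t) = 0 := by
    refine measure_mono_null (fun y hy => ?_) h0
    have := hpos y (hint hy)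
    simpa [hy.1, hy.2] using this
  simp only [Real.volume_Ioo, ENNReal.ofReal_eq_zero] at this
  linarith

theorem BasicAssumptions.lt_mcdf_of_mquantile_lt {μ : Measure ℝ} (hμ : BasicAssumptions μ)
    {u t : ℝ} (hu : u ∈ Set.Ioo (0 : ℝ) 1) (ht : mquantile μ u < t) : u < mcdf μ t := by
  have := hμ.1
  obtain ⟨r, hr⟩ :=
    ((ProbabilityTheory.tendsto_cdf_atTop μ).eventually_const_le hu.2).exists
  rw [← mcdf_eq_cdf] at hr
  obtain ⟨s, hs, hst⟩ := exists_lt_of_csInf_lt ⟨r, hr⟩ ht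
  refine lt_of_le_of_ne (le_trans hs (mcdf_mono μ hst.le)) fun hut => ?_
  have hs' : u ≤ μ.real (Set.Iic s) := hs
  have ht' : u = μ.real (Set.Iic t) := hut
  have hsplit : μ.real (Set.Ioc s t) = μ.real (Set.Iic t) - μ.real (Set.Iic s) := by
    rw [← Set.Iic_sdiff_Iic, measureReal_sdiff (Set.Iic_subset_Iic.mpr hst.le) measurableSet_Iic]
  have hzero : μ.real (Set.Ioc s t) = 0 :=
    le_antisymm (by linarith) measureReal_nonneg
  refine hμ.measure_Ioo_pos hst ?_ ?_
    (measure_mono_null Set.Ioo_subset_Ioc_self ((measureReal_eq_zero_iff).mp hzero))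
  · intro h
    rw [measureReal_def, h] at hs'
    simp at hs'
    linarith [hu.1]
  · intro h
    have h1 : μ.real (Set.Iic t)ᶜ = 1 - μ.real (Set.Iic t) :=
      probReal_compl_eq_one_sub measurableSet_Iic
    rw [Set.compl_Iic, measureReal_def, h] at h1
    simp at h1
    linarith [hu.2]

theorem BasicAssumptions.mquantile_mono {μ : Measure ℝ} (hμ : BasicAssumptions μ)
    {u w : ℝ} (hu : u ∈ Set.Ioo (0 : ℝ) 1) (hw : w ∈ Set.Ioo (0 : ℝ) 1) (huw : u ≤ w) :
    mquantile μ u ≤ mquantile μ w := by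
  have := hμ.1
  by_contra! h
  obtain ⟨t, h1, h2⟩ := exists_between h
  linarith [mcdf_lt_of_lt_mquantile μ hu.1 h2, hμ.lt_mcdf_of_mquantile_lt hw h1]

theorem sort_apply_le_iff {n : ℕ} (x : Fin n → ℝ) (m : Fin n) (t : ℝ) :
    x (Tuple.sort x m) ≤ t ↔ (m : ℕ) < (Finset.univ.filter fun i => x i ≤ t).card := by
  have h := Tuple.lt_card_le_iff_apply_le_of_monotone (j := m) (a := t)
    (Tuple.monotone_sort x)
  rw [← Function.comp_apply (f := x), ← h]
  have : (Finset.univ.filter fun i => (x ∘ Tuple.sort x) i ≤ t).card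
      = (Finset.univ.filter fun i => x i ≤ t).card :=
    Finset.card_equiv (Tuple.sort x) (by simp)
  rw [this]

/-- The empirical distribution function of a tuple of points. -/
noncomputable def empCdf {n : ℕ} (x : Fin n → ℝ) (t : ℝ) : ℝ :=
  (n : ℝ)⁻¹ * ∑ i, (Set.Iic t).indicator 1 (x i)

theorem empCdf_eq_card {n : ℕ} (x : Fin n → ℝ) (t : ℝ) :
    empCdf x t = (n : ℝ)⁻¹ * (Finset.univ.filter fun i => x i ≤ t).card := by
  simp [empCdf, Set.indicator_apply, Finset.sum_boole]

theorem measurable_sort_apply {n : ℕ} (m : Fin n) :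
    Measurable fun x : Fin n → ℝ => x (Tuple.sort x m) := by
  refine measurable_of_Iic fun t => ?_
  have hcard : Measurable fun x : Fin n → ℝ => (n : ℝ) * empCdf x t := by
    refine measurable_const.mul (measurable_const.mul (Finset.measurable_sum _ fun i _ => ?_))
    exact (measurable_one.indicator measurableSet_Iic).comp (measurable_pi_apply i)
  convert measurableSet_lt (measurable_const (a := (m : ℝ))) hcard using 1
  ext x
  have hn : (n : ℝ) ≠ 0 := by have := m.pos; positivity
  rw [Set.mem_preimage, Set.mem_Iic, sort_apply_le_iff, Set.mem_ofPred_eq, empCdf_eq_card,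
    mul_inv_cancel_left₀ hn, Nat.cast_lt]

theorem empCdf_sub_eq {n : ℕ} (hn : 0 < n) (x : Fin n → ℝ) (t c : ℝ) :
    empCdf x t - c = (n : ℝ)⁻¹ * ∑ i, ((Set.Iic t).indicator 1 (x i) - c) := by
  have : (n : ℝ) ≠ 0 := by positivity
  rw [Finset.sum_sub_distrib, empCdf]
  simp
  field_simp

theorem memLp_empCdf_sub {n : ℕ} (hn : 0 < n) (μ : Measure ℝ) [IsProbabilityMeasure μ]
    (t c : ℝ) :
    MemLp (fun x : Fin n → ℝ => empCdf x t - c) 2 (Measure.pi fun _ => μ) := by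
  have hf : MemLp (fun y : ℝ => (Set.Iic t).indicator 1 y - c) 2 μ :=
    ((memLp_const (1 : ℝ)).indicator measurableSet_Iic).sub (memLp_const c)
  simp_rw [empCdf_sub_eq hn]
  exact (memLp_finsetSum _ fun i _ =>
    hf.comp_measurePreserving (measurePreserving_eval (fun _ : Fin n => μ) i)).const_mul _

theorem integral_sq_empCdf_sub_le {n : ℕ} (hn : 0 < n) (μ : Measure ℝ) [IsProbabilityMeasure μ]
    (t : ℝ) :
    ∫ x : Fin n → ℝ, (empCdf x t - mcdf μ t) ^ 2 ∂(Measure.pi fun _ => μ) ≤ (n : ℝ)⁻¹ := by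
  set f : ℝ → ℝ := fun y => (Set.Iic t).indicator 1 y - mcdf μ t with hf
  have hfm : MemLp f 2 μ :=
    ((memLp_const (1 : ℝ)).indicator measurableSet_Iic).sub (memLp_const _)
  have hmean : ∫ y, f y ∂μ = 0 := by
    have hind : Integrable (fun y => (Set.Iic t).indicator (1 : ℝ → ℝ) y) μ :=
      (integrable_const (1 : ℝ)).indicator measurableSet_Iic
    simp only [hf]
    rw [integral_sub hind (integrable_const _), integral_indicator_one measurableSet_Iic]
    simp [mcdf, measureReal_def]
  have hvar : ProbabilityTheory.variance f μ ≤ 1 := by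
    refine (ProbabilityTheory.variance_le_expectation_sq hfm.1).trans ?_
    have h01 : 0 ≤ mcdf μ t ∧ mcdf μ t ≤ 1 :=
      ⟨ENNReal.toReal_nonneg, measureReal_le_one⟩
    calc ∫ y, (f ^ 2) y ∂μ ≤ ∫ _, (1 : ℝ) ∂μ := by
          refine integral_mono hfm.integrable_sq (integrable_const _) fun y => ?_
          simp only [Pi.pow_apply, hf, Set.indicator_apply]
          split_ifs <;> simp <;> rw [abs_le] <;> constructor <;> linarith
      _ = 1 := by simp
  have hsum : ProbabilityTheory.variance (∑ i : Fin n, fun x : Fin n → ℝ => f (x i))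
      (Measure.pi fun _ => μ) ≤ n := by
    rw [ProbabilityTheory.variance_sum_pi (fun _ => hfm)]
    simpa using mul_le_of_le_one_right (Nat.cast_nonneg n) hvar
  rw [ProbabilityTheory.variance_of_integral_eq_zero] at hsum
  · have hn' : (n : ℝ) ≠ 0 := by positivity
    have : ∀ x : Fin n → ℝ, (empCdf x t - mcdf μ t) ^ 2
        = ((n : ℝ) ^ 2)⁻¹ * ((∑ i : Fin n, fun x : Fin n → ℝ => f (x i)) x) ^ 2 := fun x => by
      rw [empCdf_sub_eq hn, mul_pow, Finset.sum_apply, inv_pow]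
    simp_rw [this]
    rw [integral_const_mul]
    calc _ ≤ ((n : ℝ) ^ 2)⁻¹ * n := by gcongr
      _ = _ := by field_simp
  · exact (Finset.aemeasurable_sum _ fun i _ =>
      (hfm.comp_measurePreserving (measurePreserving_eval (fun _ : Fin n => μ) i)).1.aemeasurable)
  · simp only [Finset.sum_apply]
    rw [integral_finsetSum _ fun i _ =>
      integrable_comp_eval (hfm.integrable (by norm_num))]
    refine Finset.sum_eq_zero fun i _ => ?_
    rw [integral_comp_eval hfm.1, hmean]

theorem min_mul_abs_sort_sub_le {n : ℕ} (x : Fin n → ℝ) (m : Fin n) (q : ℝ) :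
    min ((m : ℝ) + 1) (n - m) * |x (Tuple.sort x m) - q| ≤ ∑ i, |x i - q| := by
  rw [← Equiv.sum_comp (Tuple.sort x)]
  have hmono := Tuple.monotone_sort x
  have key (s : Finset (Fin n)) (hs : min ((m : ℝ) + 1) (n - m) ≤ s.card)
      (h : ∀ j ∈ s, |x (Tuple.sort x m) - q| ≤ |x (Tuple.sort x j) - q|) :
      min ((m : ℝ) + 1) (n - m) * |x (Tuple.sort x m) - q|
        ≤ ∑ j, |x (Tuple.sort x j) - q| :=
    calc _ ≤ s.card * |x (Tuple.sort x m) - q| := by gcongr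
      _ ≤ ∑ j ∈ s, |x (Tuple.sort x j) - q| := by
        simpa using Finset.card_nsmul_le_sum s _ _ h
      _ ≤ _ := Finset.sum_le_univ_sum_of_nonneg fun _ => abs_nonneg _
  rcases le_total q (x (Tuple.sort x m)) with hq | hq
  · refine key (Finset.Ici m) ?_ fun j hj => ?_
    · rw [Fin.card_Ici, Nat.cast_sub m.2.le]
      exact min_le_right _ _
    · have : x (Tuple.sort x m) ≤ x (Tuple.sort x j) := hmono (Finset.mem_Ici.mp hj)
      rw [abs_of_nonneg (by linarith), abs_of_nonneg (by linarith)]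
      linarith
  · refine key (Finset.Iic m) ?_ fun j hj => ?_
    · rw [Fin.card_Iic]
      push_cast
      exact min_le_left _ _
    · have : x (Tuple.sort x j) ≤ x (Tuple.sort x m) := hmono (Finset.mem_Iic.mp hj)
      rw [abs_of_nonpos (by linarith), abs_of_nonpos (by linarith)]
      linarith

theorem exists_percentileMech_eq {k n : ℕ} (hn : 0 < n) {v : Fin k → ℝ} {j : Fin k}
    (hv : v j ∈ Set.Ioo (0 : ℝ) 1) :
    ∃ m : Fin n, (m : ℝ) ≤ (n - 1) * v j ∧ (n - 1) * v j < m + 1 ∧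
      ∀ x : Fin n → ℝ, percentileMech v x j = x (Tuple.sort x m) := by
  have hn1 : (1 : ℝ) ≤ n := by exact_mod_cast hn
  have h0 : 0 ≤ ((n : ℝ) - 1) * v j := mul_nonneg (by linarith) hv.1.le
  have hfl := Nat.floor_le h0
  have hle : ⌊((n : ℝ) - 1) * v j⌋₊ ≤ n - 1 := by
    refine Nat.floor_le_of_le ?_
    rw [Nat.cast_sub hn, Nat.cast_one]
    exact mul_le_of_le_one_right (by linarith) hv.2.le
  refine ⟨⟨⌊((n : ℝ) - 1) * v j⌋₊, by omega⟩, hfl, Nat.lt_floor_add_one _, fun x => ?_⟩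
  simp only [percentileMech, dif_pos hn, min_eq_left hle]

theorem measurable_percentileMech {k n : ℕ} {v : Fin k → ℝ} {j : Fin k}
    (hv : v j ∈ Set.Ioo (0 : ℝ) 1) :
    Measurable fun x : Fin n → ℝ => percentileMech v x j := by
  rcases Nat.eq_zero_or_pos n with rfl | hn
  · exact measurable_of_countable _
  · obtain ⟨m, -, -, hm⟩ := exists_percentileMech_eq hn hv
    simp_rw [hm]
    exact measurable_sort_apply m

theorem abs_percentileMech_sub_mquantile_le {μ : Measure ℝ} (hμ : BasicAssumptions μ) {k : ℕ}
    {v : Fin k → ℝ} {j : Fin k} (hv : v j ∈ Set.Ioo (0 : ℝ) 1) {ε : ℝ} (hε : 0 < ε) :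
    ∃ K c s t : ℝ, 0 < c ∧ ∀ M ≥ 0, ∀ᶠ n : ℕ in atTop, ∀ x : Fin n → ℝ,
      |percentileMech v x j - mquantile μ (v j)| ≤
        ε + c * (M * K * ((empCdf x s - mcdf μ s) ^ 2 + (empCdf x t - mcdf μ t) ^ 2)
          + (n : ℝ)⁻¹ * ∑ i, max (|x i - mquantile μ (v j)| - M) 0) := by
  have := hμ.1
  set q := mquantile μ (v j)
  set u := v j
  have hs : mcdf μ (q - ε) < u := mcdf_lt_of_lt_mquantile μ hv.1 (by linarith)
  have ht : u < mcdf μ (q + ε) := hμ.lt_mcdf_of_mquantile_lt hv (by linarith)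
  obtain ⟨δ, hδ, hδs, hδt⟩ : ∃ δ > 0, δ ≤ (u - mcdf μ (q - ε)) / 2 ∧ δ ≤ mcdf μ (q + ε) - u :=
    ⟨min ((u - mcdf μ (q - ε)) / 2) (mcdf μ (q + ε) - u),
      lt_min (by linarith) (by linarith), min_le_left _ _, min_le_right _ _⟩
  obtain ⟨c, hc, hc1, hc2⟩ : ∃ c > 0, c ≤ 1 - u ∧ c ≤ u / 2 :=
    ⟨min (1 - u) (u / 2), lt_min (by linarith [hv.2]) (by linarith [hv.1]),
      min_le_left _ _, min_le_right _ _⟩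
  refine ⟨(δ ^ 2)⁻¹, c⁻¹, q - ε, q + ε, by positivity, fun M hM => ?_⟩
  have hlarge : ∀ᶠ n : ℕ in atTop, u ≤ n * δ :=
    (tendsto_natCast_atTop_atTop.atTop_mul_const hδ).eventually_ge_atTop u
  filter_upwards [eventually_ge_atTop 2, hlarge] with n hn2 hnδ x
  obtain ⟨m, hm1, hm2, hmx⟩ := exists_percentileMech_eq (n := n) (by omega) hv
  rw [hmx]
  set y := x (Tuple.sort x m)
  have hn : (2 : ℝ) ≤ n := by exact_mod_cast hn2
  have hn0 : (0 : ℝ) < n := by linarith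
  set R := (n : ℝ)⁻¹ * ∑ i, max (|x i - q| - M) 0 with hR
  have hR0 : 0 ≤ R := by positivity
  set D := (empCdf x (q - ε) - mcdf μ (q - ε)) ^ 2 + (empCdf x (q + ε) - mcdf μ (q + ε)) ^ 2
    with hD
  by_cases hyq : |y - q| ≤ ε
  · have : 0 ≤ c⁻¹ * (M * (δ ^ 2)⁻¹ * D + R) := by positivity
    linarith
  · have hbound : c * |y - q| ≤ M + R := by
      have h1 : (n * c) * |y - q| ≤ ∑ i, |x i - q| := by
        refine le_trans (mul_le_mul_of_nonneg_right (le_min ?_ ?_) (abs_nonneg _))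
          (min_mul_abs_sort_sub_le x m q)
        · nlinarith [hv.1]
        · nlinarith [hv.1]
      have h2 : ∑ i, |x i - q| ≤ n * (M + R) := by
        calc ∑ i, |x i - q| ≤ ∑ i, (M + max (|x i - q| - M) 0) :=
              Finset.sum_le_sum fun i _ => by linarith [le_max_left (|x i - q| - M) 0]
          _ = n * (M + R) := by
            rw [Finset.sum_add_distrib, hR]
            simp
            field_simp
      have h3 : n * (c * |y - q|) ≤ n * (M + R) := by linarith
      exact le_of_mul_le_mul_left h3 hn0
    have hdev : δ ^ 2 ≤ D := by
      rw [not_le, lt_abs] at hyq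
      rcases hyq with h | h
      · have hcount : ¬ y ≤ q + ε := by linarith
        rw [sort_apply_le_iff, not_lt] at hcount
        have hcast : ((Finset.univ.filter fun i => x i ≤ q + ε).card : ℝ) ≤ m := by
          exact_mod_cast hcount
        have hemp : empCdf x (q + ε) ≤ u := by
          rw [empCdf_eq_card, inv_mul_le_iff₀ hn0]
          nlinarith [hv.1]
        nlinarith [sq_nonneg (empCdf x (q - ε) - mcdf μ (q - ε))]
      · have hcount : y ≤ q - ε := by linarith
        rw [sort_apply_le_iff, ← Nat.add_one_le_iff] at hcount
        have hcast : (m : ℝ) + 1 ≤ (Finset.univ.filter fun i => x i ≤ q - ε).card := by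
          exact_mod_cast hcount
        have hemp : u - δ ≤ empCdf x (q - ε) := by
          rw [empCdf_eq_card, le_inv_mul_iff₀ hn0]
          nlinarith
        nlinarith [sq_nonneg (empCdf x (q + ε) - mcdf μ (q + ε))]
    have hdev' : 1 ≤ (δ ^ 2)⁻¹ * D := by
      rw [le_inv_mul_iff₀ (by positivity)]
      linarith
    have : |y - q| ≤ c⁻¹ * (M * (δ ^ 2)⁻¹ * D + R) := by
      rw [le_inv_mul_iff₀ hc]
      nlinarith
    linarith

theorem tendsto_integral_max_sub_zero {μ : Measure ℝ} {f : ℝ → ℝ} (hf : Integrable f μ) :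
    Tendsto (fun N : ℕ => ∫ a, max (|f a| - N) 0 ∂μ) atTop (𝓝 0) := by
  have h := tendsto_integral_of_dominated_convergence (μ := μ)
    (F := fun (N : ℕ) a => max (|f a| - N) 0) (f := fun _ => 0) (fun a => |f a|)
    (fun N => (hf.abs.1.sub aestronglyMeasurable_const).sup aestronglyMeasurable_const)
    hf.abs (fun N => ae_of_all _ fun a => ?_) (ae_of_all _ fun a => ?_)
  · simpa using h
  · rw [Real.norm_of_nonneg (le_max_right _ _)]
    exact max_le (by linarith [Nat.cast_nonneg (α := ℝ) N]) (abs_nonneg _)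
  · refine tendsto_const_nhds.congr' ?_
    filter_upwards [tendsto_natCast_atTop_atTop.eventually_ge_atTop |f a|] with N hN
    rw [max_eq_right (by linarith)]

theorem integrable_percentileMech_sub {μ : Measure ℝ} [IsProbabilityMeasure μ]
    (hint : Integrable (fun x : ℝ => x) μ) {k n : ℕ} {v : Fin k → ℝ} {j : Fin k}
    (hv : v j ∈ Set.Ioo (0 : ℝ) 1) (q : ℝ) :
    Integrable (fun x : Fin n → ℝ => percentileMech v x j - q) (Measure.pi fun _ => μ) := by
  refine Integrable.sub ?_ (integrable_const q)
  rcases Nat.eq_zero_or_pos n with rfl | hn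
  · simp [percentileMech]
  obtain ⟨m, -, -, hm⟩ := exists_percentileMech_eq hn hv
  refine Integrable.mono' (g := fun x => ∑ i, |x i|)
    (integrable_finsetSum _ fun i _ => 
      integrable_comp_eval (μ := fun _ : Fin n => μ) (f := fun y : ℝ => |y|) hint.abs)
    (measurable_percentileMech hv).aestronglyMeasurable (ae_of_all _ fun x => ?_)
  rw [hm, Real.norm_eq_abs]
  exact Finset.single_le_sum (f := fun i => |x i|) (fun _ _ => abs_nonneg _) (Finset.mem_univ _)

theorem tendsto_integral_abs_percentileMech_sub {μ : Measure ℝ} (hμ : BasicAssumptions μ)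
    (hint : Integrable (fun x : ℝ => x) μ) {k : ℕ}
    {v : Fin k → ℝ} {j : Fin k} (hv : v j ∈ Set.Ioo (0 : ℝ) 1) :
    Tendsto (fun n : ℕ => ∫ x : Fin n → ℝ, |percentileMech v x j - mquantile μ (v j)|
      ∂(Measure.pi fun _ => μ)) atTop (𝓝 0) := by
  have := hμ.1
  set q := mquantile μ (v j)
  have hintq : Integrable (fun x : ℝ => x - q) μ := hint.sub (integrable_const q)
  refine tendsto_order.2 ⟨fun a ha => Eventually.of_forall fun n =>
    ha.trans_le (integral_nonneg fun x => abs_nonneg _), fun a ha => ?_⟩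
  obtain ⟨K, c, s, t, hc, hbound⟩ :=
    abs_percentileMech_sub_mquantile_le hμ hv (show 0 < a / 3 by linarith)
  obtain ⟨N, hN⟩ := ((tendsto_integral_max_sub_zero hintq).eventually_lt_const
    (show 0 < a / 3 / c by positivity)).exists
  have hN' : c * ∫ y, max (|y - q| - N) 0 ∂μ < a / 3 := by
    rw [lt_div_iff₀ hc] at hN
    linarith
  have hmax : Integrable (fun y : ℝ => max (|y - q| - N) 0) μ :=
    (hintq.abs.sub (integrable_const _)).sup (integrable_const 0)
  have hsmall : ∀ᶠ n : ℕ in atTop, c * (N * |K| * ((n : ℝ)⁻¹ + (n : ℝ)⁻¹)) < a / 3 := by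
    have h : Tendsto (fun n : ℕ => c * (N * |K| * ((n : ℝ)⁻¹ + (n : ℝ)⁻¹))) atTop
        (𝓝 (c * (N * |K| * (0 + 0)))) :=
      ((tendsto_inv_atTop_nhds_zero_nat.add tendsto_inv_atTop_nhds_zero_nat).const_mul _).const_mul _
    exact h.eventually_lt_const (by simp; linarith)
  filter_upwards [hbound N (Nat.cast_nonneg N), hsmall, eventually_gt_atTop 0] with n hb hsm hn
  have hn0 : (n : ℝ) ≠ 0 := by positivity
  have hsq (r : ℝ) := (memLp_empCdf_sub hn μ r (mcdf μ r)).integrable_sq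
  have hev (i : Fin n) := integrable_comp_eval (μ := fun _ : Fin n => μ) (i := i) hmax
  have hsum := (integrable_finsetSum Finset.univ fun i _ => hev i).const_mul (n : ℝ)⁻¹
  have hD : Integrable (fun x : Fin n → ℝ => N * |K| * ((empCdf x s - mcdf μ s) ^ 2
      + (empCdf x t - mcdf μ t) ^ 2)) (Measure.pi fun _ => μ) :=
    ((hsq s).add (hsq t)).const_mul (N * |K|)
  have hall : Integrable (fun x : Fin n → ℝ => c * (N * |K| * ((empCdf x s - mcdf μ s) ^ 2
      + (empCdf x t - mcdf μ t) ^ 2) + (n : ℝ)⁻¹ * ∑ i, max (|x i - q| - N) 0))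
      (Measure.pi fun _ => μ) :=
    (hD.add hsum).const_mul c
  calc ∫ x : Fin n → ℝ, |percentileMech v x j - q| ∂(Measure.pi fun _ => μ)
      ≤ ∫ x : Fin n → ℝ, (a / 3 + c * (N * |K| * ((empCdf x s - mcdf μ s) ^ 2
          + (empCdf x t - mcdf μ t) ^ 2) + (n : ℝ)⁻¹ * ∑ i, max (|x i - q| - N) 0))
          ∂(Measure.pi fun _ => μ) := by
        refine integral_mono (integrable_percentileMech_sub hint hv q).abs
          ((integrable_const _).add hall) fun x => (hb x).trans ?_
        gcongr
        exact le_abs_self K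
    _ = a / 3 + c * (N * |K| * (∫ x : Fin n → ℝ, (empCdf x s - mcdf μ s) ^ 2
          ∂(Measure.pi fun _ => μ) + ∫ x : Fin n → ℝ, (empCdf x t - mcdf μ t) ^ 2
          ∂(Measure.pi fun _ => μ)) + ∫ y, max (|y - q| - N) 0 ∂μ) := by
        rw [integral_add (integrable_const _) hall, integral_const_mul,
          integral_add hD hsum, integral_const_mul, integral_const_mul,
          integral_add (hsq s) (hsq t), integral_finsetSum _ fun i _ => hev i]
        simp_rw [integral_comp_eval (μ := fun _ : Fin n => μ) hmax.1]
        simp [hn0]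
    _ ≤ a / 3 + c * (N * |K| * ((n : ℝ)⁻¹ + (n : ℝ)⁻¹) + ∫ y, max (|y - q| - N) 0 ∂μ) := by
        gcongr <;> exact integral_sq_empCdf_sub_le hn μ _
    _ < a := by linarith

/-- The union of the first `j` Voronoi cells of the points `q 0 ≤ q 1 ≤ ⋯ ≤ q (k-1)`. -/
noncomputable def voronoiLower {k : ℕ} (q : Fin k → ℝ) (j : ℕ) : Set ℝ :=
  if h0 : j = 0 then ∅
  else if hk : k ≤ j then Set.univ
  else Set.Iic ((q ⟨j - 1, by omega⟩ + q ⟨j, by omega⟩) / 2)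

/-- The Voronoi cell of the point `q i` among `q 0 ≤ q 1 ≤ ⋯ ≤ q (k-1)`, half-open. -/
noncomputable def voronoiCell {k : ℕ} (q : Fin k → ℝ) (i : Fin k) : Set ℝ :=
  voronoiLower q (i + 1) \ voronoiLower q i

theorem voronoiLower_mono {k : ℕ} {q : Fin k → ℝ} (hq : Monotone q) :
    Monotone (voronoiLower q) := by
  intro a b hab
  unfold voronoiLower
  split_ifs with h1 h2 h3 h4 h5 h6
  any_goals first | omega | simp
  have h7 : q ⟨a - 1, by omega⟩ ≤ q ⟨b - 1, by omega⟩ := hq (Fin.mk_le_mk.mpr (by omega))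
  have h8 : q ⟨a, by omega⟩ ≤ q ⟨b, by omega⟩ := hq (Fin.mk_le_mk.mpr hab)
  linarith

theorem measurableSet_voronoiLower {k : ℕ} (q : Fin k → ℝ) (j : ℕ) :
    MeasurableSet (voronoiLower q j) := by
  unfold voronoiLower
  split_ifs <;> simp

theorem measurableSet_voronoiCell {k : ℕ} (q : Fin k → ℝ) (i : Fin k) :
    MeasurableSet (voronoiCell q i) :=
  MeasurableSet.diff (measurableSet_voronoiLower q _) (measurableSet_voronoiLower q _)

theorem cellBd_eq_measureReal (μ : Measure ℝ) [IsProbabilityMeasure μ] {k : ℕ} (q : Fin k → ℝ)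
    (j : ℕ) : cellBd μ q j = μ.real (voronoiLower q j) := by
  unfold cellBd voronoiLower
  split_ifs <;> simp [mcdf, measureReal_def]

theorem measure_voronoiCell (μ : Measure ℝ) [IsProbabilityMeasure μ] {k : ℕ} {q : Fin k → ℝ}
    (hq : Monotone q) (i : Fin k) :
    μ (voronoiCell q i) = ENNReal.ofReal (cellBd μ q (i + 1) - cellBd μ q i) := by
  rw [cellBd_eq_measureReal, cellBd_eq_measureReal,
    ← measureReal_sdiff (voronoiLower_mono hq (Nat.le_succ _)) (measurableSet_voronoiLower q _)]
  exact (ofReal_measureReal).symm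

theorem pairwise_disjoint_voronoiCell {k : ℕ} {q : Fin k → ℝ} (hq : Monotone q) :
    Pairwise (Function.onFun Disjoint (voronoiCell q)) := by
  refine (pairwise_disjoint_on _).2 fun i j hij => ?_
  exact Set.disjoint_sdiff_right.mono_left
    (Set.sdiff_subset.trans (voronoiLower_mono hq (Nat.succ_le_of_lt hij)))

theorem iUnion_voronoiCell {k : ℕ} (hk : 1 ≤ k) (q : Fin k → ℝ) :
    ⋃ i, voronoiCell q i = Set.univ := by
  classical
  refine Set.eq_univ_of_forall fun x => ?_
  have hex : ∃ j, x ∈ voronoiLower q (j + 1) :=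
    ⟨k - 1, by rw [voronoiLower, dif_neg (by omega), dif_pos (by omega)]; trivial⟩
  have hmin : Nat.find hex ≤ k - 1 := Nat.find_min' hex
    (by rw [voronoiLower, dif_neg (by omega), dif_pos (by omega)]; trivial)
  refine Set.mem_iUnion.2 ⟨⟨Nat.find hex, by omega⟩, Nat.find_spec hex, ?_⟩
  have hnot : ∀ N, Nat.find hex = N → x ∉ voronoiLower q N
    | 0, _ => by simp [voronoiLower]
    | j + 1, h => Nat.find_min hex (m := j) (by omega)
  exact hnot _ rfl

theorem sum_restrict_voronoiCell (μ : Measure ℝ) {k : ℕ} (hk : 1 ≤ k) {q : Fin k → ℝ}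
    (hq : Monotone q) : ∑ i, μ.restrict (voronoiCell q i) = μ := by
  rw [← Measure.sum_fintype, ← Measure.restrict_iUnion (pairwise_disjoint_voronoiCell hq)
    (measurableSet_voronoiCell q), iUnion_voronoiCell hk, Measure.restrict_univ]

theorem abs_sub_eq_iInf_of_mem_voronoiCell {k : ℕ} {q : Fin k → ℝ} (hq : Monotone q) {i : Fin k}
    {x : ℝ} (hx : x ∈ voronoiCell q i) : |x - q i| = ⨅ j, |x - q j| := by
  have : Nonempty (Fin k) := ⟨i⟩
  refine le_antisymm (le_ciInf fun j => ?_) (ciInf_le (Set.finite_range _).bddBelow i)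
  obtain ⟨hx1, hx2⟩ := hx
  have hi := i.2
  have hj := j.2
  rcases lt_trichotomy i j with hij | rfl | hij
  · rw [Fin.lt_def] at hij
    rw [voronoiLower, dif_neg (by omega), dif_neg (by omega), Set.mem_Iic] at hx1
    have h1 : q ⟨i + 1, by omega⟩ ≤ q j := hq (Fin.le_def.2 hij)
    have h2 : q i ≤ q ⟨i + 1, by omega⟩ := hq (Fin.le_def.2 (Nat.le_succ _))
    simp only [Nat.add_sub_cancel, Fin.eta] at hx1
    exact abs_le.2 ⟨by linarith [neg_le_abs (x - q j)], by linarith [neg_le_abs (x - q j)]⟩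
  · exact le_rfl
  · rw [Fin.lt_def] at hij
    rw [voronoiLower, dif_neg (by omega), dif_neg (by omega), Set.mem_Iic, not_le] at hx2
    have h1 : q j ≤ q ⟨i - 1, by omega⟩ := hq (Fin.le_def.2 (by simp; omega))
    have h2 : q ⟨i - 1, by omega⟩ ≤ q i := hq (Fin.le_def.2 (by simp))
    simp only [Fin.eta] at hx2
    exact abs_le.2 ⟨by linarith [le_abs_self (x - q j)], by linarith [le_abs_self (x - q j)]⟩

theorem measurable_iInf_abs_sub {k : ℕ} (q : Fin k → ℝ) :
    Measurable fun x : ℝ => ⨅ j, |x - q j| :=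
  Measurable.iInf fun j => (measurable_id.sub_const (q j)).abs

theorem integrable_iInf_abs_sub {μ : Measure ℝ} [IsProbabilityMeasure μ]
    (hint : Integrable (fun x : ℝ => x) μ) {k : ℕ} (hk : 1 ≤ k) (q : Fin k → ℝ) :
    Integrable (fun x : ℝ => ⨅ j, |x - q j|) μ := by
  have : Nonempty (Fin k) := ⟨⟨0, hk⟩⟩
  refine (hint.sub (integrable_const (q ⟨0, hk⟩))).mono
    (measurable_iInf_abs_sub q).aestronglyMeasurable (ae_of_all _ fun x => ?_)
  rw [Real.norm_of_nonneg (Real.iInf_nonneg fun _ => abs_nonneg _)]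
  exact ciInf_le (Set.finite_range fun j => |x - q j|).bddBelow _

theorem map_finsetSum_measure {α β ι : Type*} [MeasurableSpace α] [MeasurableSpace β]
    {f : α → β} (hf : Measurable f) (s : Finset ι) (μ : ι → Measure α) :
    (∑ i ∈ s, μ i).map f = ∑ i ∈ s, (μ i).map f := by
  simp_rw [← Measure.mapₗ_apply_of_measurable hf, map_sum]

/-- The distance from `μ` to its Voronoi projection onto finitely many points is the mean
distance to those points. -/
theorem W1_sum_voronoiCell {μ : Measure ℝ} [IsProbabilityMeasure μ]
    (hint : Integrable (fun x : ℝ => x) μ) {k : ℕ} (hk : 1 ≤ k) {q : Fin k → ℝ}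
    (hq : Monotone q) :
    W1 μ (∑ i, μ (voronoiCell q i) • Measure.dirac (q i)) = ∫ x, ⨅ j, |x - q j| ∂μ := by
  have : Nonempty (Fin k) := ⟨⟨0, hk⟩⟩
  have hmap (i : Fin k) : Measurable fun x : ℝ => (x, q i) := by fun_prop
  refine IsLeast.csInf_eq ⟨?_, ?_⟩
  · set π : Measure (ℝ × ℝ) := ∑ i, (μ.restrict (voronoiCell q i)).map fun x => (x, q i) with hπ
    have hfst : π.map Prod.fst = μ := by
      rw [hπ, map_finsetSum_measure measurable_fst]
      conv_rhs => rw [← sum_restrict_voronoiCell μ hk hq]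
      refine Finset.sum_congr rfl fun i _ => ?_
      rw [Measure.map_map measurable_fst (hmap i)]
      exact Measure.map_id
    have hprob : IsProbabilityMeasure π :=
      (Measure.isProbabilityMeasure_map_iff measurable_fst.aemeasurable).1 (hfst ▸ ‹_›)
    refine ⟨π, hprob, hfst, ?_, ?_⟩
    · rw [hπ, map_finsetSum_measure measurable_snd]
      refine Finset.sum_congr rfl fun i _ => ?_
      rw [Measure.map_map measurable_snd (hmap i)]
      change Measure.map (fun _ => q i) _ = _
      rw [Measure.map_const, Measure.restrict_apply_univ]
    · have hcost (i : Fin k) : Integrable (fun p : ℝ × ℝ => |p.1 - p.2|)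
          ((μ.restrict (voronoiCell q i)).map fun x => (x, q i)) :=
        (integrable_map_measure (by fun_prop) (hmap i).aemeasurable).2
          (hint.restrict.sub (integrable_const (q i))).abs
      have hg := integrable_iInf_abs_sub hint hk q
      rw [hπ, integral_finsetSum_measure fun i _ => hcost i]
      conv_lhs => rw [← sum_restrict_voronoiCell μ hk hq]
      rw [integral_finsetSum_measure fun i _ => hg.restrict]
      refine Finset.sum_congr rfl fun i _ => ?_
      rw [integral_map (hmap i).aemeasurable (by fun_prop)]
      exact setIntegral_congr_fun (measurableSet_voronoiCell q i) fun x hx =>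
        (abs_sub_eq_iInf_of_mem_voronoiCell hq hx).symm
  · rintro c ⟨π, hprob, hfst, hsnd, rfl⟩
    have hsupp : ∀ᵐ p ∂π, p.2 ∈ Set.range q := by
      refine ae_of_ae_map (f := Prod.snd) (p := fun y => y ∈ Set.range q)
        measurable_snd.aemeasurable ?_
      rw [hsnd, ae_iff]
      simp [Measure.finsetSum_apply]
    have hint1 : Integrable (fun p : ℝ × ℝ => p.1) π := by
      rw [← hfst] at hint
      exact hint.comp_measurable measurable_fst
    have hint2 : Integrable (fun p : ℝ × ℝ => p.2) π := by
      refine Integrable.of_bound measurable_snd.aestronglyMeasurable (∑ j, |q j|) ?_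
      filter_upwards [hsupp] with p ⟨j, hj⟩
      rw [← hj, Real.norm_eq_abs]
      exact Finset.single_le_sum (f := fun j => |q j|) (fun _ _ => abs_nonneg _)
        (Finset.mem_univ j)
    have hg := integrable_iInf_abs_sub hint hk q
    rw [← hfst, integral_map measurable_fst.aemeasurable
      (measurable_iInf_abs_sub q).aestronglyMeasurable]
    rw [← hfst] at hg
    refine integral_mono_ae (hg.comp_measurable measurable_fst) (hint1.sub hint2).abs ?_
    filter_upwards [hsupp] with p ⟨j, hj⟩
    change ⨅ j, |p.1 - q j| ≤ |p.1 - p.2|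
    rw [← hj]
    exact ciInf_le (Set.finite_range fun j => |p.1 - q j|).bddBelow j

theorem BasicAssumptions.W1_nuQ {μ : Measure ℝ} (hμ : BasicAssumptions μ)
    (hint : Integrable (fun x : ℝ => x) μ) {k : ℕ} (hk : 1 ≤ k) {v : Fin k → ℝ}
    (hv : Monotone v) (hv01 : ∀ j, v j ∈ Set.Ioo (0 : ℝ) 1) :
    W1 μ (nuQ μ v) = ∫ x, ⨅ j, |x - mquantile μ (v j)| ∂μ := by
  have := hμ.1
  have hq : Monotone fun j => mquantile μ (v j) := fun i j hij =>
    hμ.mquantile_mono (hv01 i) (hv01 j) (hv hij)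
  rw [← W1_sum_voronoiCell hint hk hq, nuQ]
  simp_rw [measure_voronoiCell μ hq]

theorem abs_SC_sub_SC_le {n k : ℕ} (x : Fin n → ℝ) (y z : Fin k → ℝ) :
    |SC x y - SC x z| ≤ ∑ j, |y j - z j| := by
  have hinf (a : ℝ) (y z : Fin k → ℝ) :
      (⨅ j, |a - y j|) - (⨅ j, |a - z j|) ≤ ∑ j, |y j - z j| := by
    rcases isEmpty_or_nonempty (Fin k) with h | h
    · simp
    obtain ⟨j, hj⟩ := exists_eq_ciInf_of_finite (f := fun j => |a - z j|)
    have h1 : (⨅ j, |a - y j|) ≤ |a - y j| :=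
      ciInf_le (Set.finite_range fun j => |a - y j|).bddBelow j
    have h2 : |y j - z j| ≤ ∑ j, |y j - z j| :=
      Finset.single_le_sum (f := fun j => |y j - z j|) (fun _ _ => abs_nonneg _)
        (Finset.mem_univ j)
    have h3 : |a - y j| ≤ |a - z j| + |z j - y j| := abs_sub_le _ _ _
    rw [abs_sub_comm (z j)] at h3
    linarith
  have habs (a : ℝ) : |(⨅ j, |a - y j|) - (⨅ j, |a - z j|)| ≤ ∑ j, |y j - z j| := by
    refine abs_sub_le_iff.2 ⟨hinf a y z, ?_⟩
    simpa only [abs_sub_comm (z _)] using hinf a z y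
  rw [SC, SC, ← mul_sub, ← Finset.sum_sub_distrib, abs_mul, abs_of_nonneg (by positivity)]
  refine inv_mul_le_of_le_mul₀ (Nat.cast_nonneg n)
    (Finset.sum_nonneg fun _ _ => abs_nonneg _) ((Finset.abs_sum_le_sum_abs _ _).trans ?_)
  simpa using Finset.sum_le_card_nsmul Finset.univ _ _ fun i _ => habs (x i)

theorem integrable_SC {μ : Measure ℝ} [IsProbabilityMeasure μ]
    (hint : Integrable (fun x : ℝ => x) μ) {k : ℕ} (hk : 1 ≤ k) (q : Fin k → ℝ) (n : ℕ) :
    Integrable (fun x : Fin n → ℝ => SC x q) (Measure.pi fun _ => μ) :=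
  (integrable_finsetSum _ fun i _ => integrable_comp_eval (μ := fun _ : Fin n => μ) (i := i)
    (integrable_iInf_abs_sub hint hk q)).const_mul _

theorem integral_SC {μ : Measure ℝ} [IsProbabilityMeasure μ]
    (hint : Integrable (fun x : ℝ => x) μ) {k : ℕ} (hk : 1 ≤ k) (q : Fin k → ℝ) {n : ℕ}
    (hn : 0 < n) :
    ∫ x : Fin n → ℝ, SC x q ∂(Measure.pi fun _ => μ) = ∫ x, ⨅ j, |x - q j| ∂μ := by
  have hn0 : (n : ℝ) ≠ 0 := by positivity
  have hg := integrable_iInf_abs_sub hint hk q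
  simp only [SC]
  rw [integral_const_mul, integral_finsetSum _ fun i _ =>
    integrable_comp_eval (μ := fun _ : Fin n => μ) (i := i) hg]
  simp_rw [integral_comp_eval (μ := fun _ : Fin n => μ) hg.1]
  simp [hn0]

theorem measurable_SCv {k n : ℕ} {v : Fin k → ℝ} (hv01 : ∀ j, v j ∈ Set.Ioo (0 : ℝ) 1) :
    Measurable fun x : Fin n → ℝ => SCv v x :=
  (Finset.measurable_sum _ fun i _ => Measurable.iInf fun j =>
    ((measurable_pi_apply i).sub (measurable_percentileMech (hv01 j))).abs).const_mul _

/-- The expected social cost of the percentile mechanism converges to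
`W₁(μ, ν_{Q_v})`. -/
theorem stmt4 (μ : Measure ℝ) (hμ : BasicAssumptions μ)
    (hint : Integrable (fun x : ℝ => |x|) μ) {k : ℕ} (hk : 1 ≤ k)
    (v : Fin k → ℝ) (hv : Monotone v) (hv01 : ∀ j, v j ∈ Set.Ioo (0 : ℝ) 1) :
    Tendsto (fun n : ℕ => ∫ x : Fin n → ℝ, SCv v x ∂(Measure.pi fun _ : Fin n => μ))
      atTop (𝓝 (W1 μ (nuQ μ v))) := by
  have := hμ.1
  have hid : Integrable (fun x : ℝ => x) μ := (integrable_norm_iff (by fun_prop)).1 hint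
  set q : Fin k → ℝ := fun j => mquantile μ (v j)
  rw [hμ.W1_nuQ hid hk hv hv01]
  have hdiff (n : ℕ) (j : Fin k) :=
    (integrable_percentileMech_sub (n := n) hid (hv01 j) (q j)).abs
  have hsum : Tendsto (fun n : ℕ => ∑ j, ∫ x : Fin n → ℝ, |percentileMech v x j - q j|
      ∂(Measure.pi fun _ => μ)) atTop (𝓝 0) := by
    simpa using tendsto_finsetSum Finset.univ fun j _ =>
      tendsto_integral_abs_percentileMech_sub hμ hid (hv01 j)
  refine tendsto_iff_dist_tendsto_zero.2 (squeeze_zero' (Eventually.of_forall fun _ =>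
    dist_nonneg) ?_ hsum)
  filter_upwards [eventually_gt_atTop 0] with n hn
  have hSC := integrable_SC hid hk q n
  have hbound (x : Fin n → ℝ) : |SCv v x - SC x q| ≤ ∑ j, |percentileMech v x j - q j| :=
    abs_SC_sub_SC_le x _ q
  have hdev : Integrable (fun x : Fin n → ℝ => SCv v x - SC x q) (Measure.pi fun _ => μ) :=
    (integrable_finsetSum _ fun j _ => hdiff n j).mono'
      ((measurable_SCv hv01).aestronglyMeasurable.sub hSC.1) (ae_of_all _ hbound)
  have hSCv : Integrable (fun x : Fin n → ℝ => SCv v x) (Measure.pi fun _ => μ) := 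
    (hdev.add hSC).congr (ae_of_all _ fun x => sub_add_cancel _ _)
  rw [← integral_SC hid hk q hn, Real.dist_eq, ← integral_sub hSCv hSC,
    ← integral_finsetSum _ fun j _ => hdiff n j]
  exact abs_integral_le_integral_abs.trans
    (integral_mono hdev.abs (integrable_finsetSum _ fun j _ => hdiff n j) hbound)
end
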